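/- In the ring A = Z[x_1,x_2,x_3,y_{12},y_{13},y_{23}]/(x_1^3,x_2^3,x_3^3,y_{12}^3,y_{13}^3,y_{23}^3), the degree (coefficient of x_1^2 x_2^2 x_3^2 y_{12}^2 y_{13}^2 y_{23}^2) of the class ∏_{1≤i<j≤3}(x_i+y_{ij})(x_j+y_{ij}) · (x_1+x_2+x_3)^3 · (y_{12}+y_{13}+y_{23})^3 equals 6·57 = 342. -/

import Mathlib

open MvPolynomial

/-- Variables: `x₁,x₂,x₃ = X 0, X 1, X 2`; `y₁₂,y₁₃,y₂₃ = X 3, X 4, X 5`.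
The class `[M] = ∏_{1≤i<j≤3} (xᵢ+y_{ij})(x_j+y_{ij})`. -/
noncomputable def threeLinesClass : MvPolynomial (Fin 6) ℤ :=
  (X 0 + X 3) * (X 1 + X 3) * (X 0 + X 4) * (X 2 + X 4) * (X 1 + X 5) * (X 2 + X 5)

/-- The number of ways to choose one variable from each list of `L` so that the variable `i` is
chosen exactly `m i` times, where `support` lists all variables. -/
def countChoices {σ : Type*} [DecidableEq σ] : List (List σ) → (σ → ℕ) → List σ → ℕ
  | [], m, support => if ∀ i ∈ support, m i = 0 then 1 else 0
  | l :: L, m, support =>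
    (l.map fun i => if m i = 0 then 0
      else countChoices L (Function.update m i (m i - 1)) support).sum

theorem coeff_sum_X_mul {σ R : Type*} [DecidableEq σ] [CommSemiring R] (m : σ →₀ ℕ) (l : List σ)
    (p : MvPolynomial σ R) :
    coeff m ((l.map X).sum * p) =
      (l.map fun i => if m i = 0 then 0 else coeff (m - Finsupp.single i 1) p).sum := by
  induction l with
  | nil => simp
  | cons i l ih =>
    simp [add_mul, coeff_X_mul', ih, Finsupp.mem_support_iff, ite_not]

/-- A coefficient of a product of sums of variables counts choices of one variable per factor. -/
theorem coeff_prod_sum_X {σ R : Type*} [DecidableEq σ] [CommSemiring R] (L : List (List σ))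
    (m : σ →₀ ℕ) (support : List σ) (h : ∀ i, i ∈ support) :
    coeff m ((L.map fun l => (l.map (X (R := R))).sum).prod) =
      (countChoices L m support : R) := by
  induction L generalizing m with
  | nil =>
    have hm : 0 = m ↔ ∀ i ∈ support, m i = 0 := by
      simp [Finsupp.ext_iff, h, eq_comm]
    simp [countChoices, coeff_one, hm]
  | cons l L ih =>
    rw [List.map_cons, List.prod_cons, coeff_sum_X_mul, countChoices, Nat.cast_list_sum,
      List.map_map]
    congr 1
    refine List.map_congr_left fun i _ => ?_
    have hm : ⇑(m - Finsupp.single i 1 : σ →₀ ℕ) = Function.update m i (m i - 1) := by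
      ext j
      by_cases hj : j = i
      · subst hj; simp
      · simp [hj]
    simp only [Function.comp_apply, ih, hm]
    split_ifs <;> simp

/-- The degree (coefficient of the top monomial `x₁²x₂²x₃²y₁₂²y₁₃²y₂₃²`) of
`[M]·(x₁+x₂+x₃)³·(y₁₂+y₁₃+y₂₃)³` equals `6·57 = 342`.  (The top coefficient in the
polynomial ring agrees with the computation in the quotient by the cubes.) -/
theorem degree_threeLines_three_points_three_lines :
    MvPolynomial.coeff (Finsupp.equivFunOnFinite.symm fun _ : Fin 6 => (2 : ℕ))
      (threeLinesClass * (X 0 + X 1 + X 2) ^ 3 * (X 3 + X 4 + X 5) ^ 3) = 342 := by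
  let L : List (List (Fin 6)) :=
    [[0, 3], [1, 3], [0, 4], [2, 4], [1, 5], [2, 5],
      [0, 1, 2], [0, 1, 2], [0, 1, 2], [3, 4, 5], [3, 4, 5], [3, 4, 5]]
  have hL : threeLinesClass * (X 0 + X 1 + X 2) ^ 3 * (X 3 + X 4 + X 5) ^ 3 =
      (L.map fun l => (l.map (X (R := ℤ))).sum).prod := by
    simp only [L, threeLinesClass, List.map_cons, List.map_nil, List.sum_cons, List.sum_nil,
      List.prod_cons, List.prod_nil, add_zero, mul_one, pow_succ, pow_zero, one_mul, mul_assoc,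
      add_assoc]
  have hcount : countChoices L (fun _ => 2) (List.finRange 6) = 342 := by decide +kernel
  rw [hL, coeff_prod_sum_X L _ (List.finRange 6) List.mem_finRange,
    Finsupp.coe_equivFunOnFinite_symm, hcount]
  rfl
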